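/- (Lemma 1 of the paper.) Let φ : ℝ × ℝ → ℝ be a transcoding-latency function satisfying: φ(r₁, r₂) ≥ 0 for all r₁, r₂; φ(r₁, r₂) = 0 whenever r₁ ≤ r₂; and φ is monotone on the transcoding region, i.e., whenever r₂ < r₁, r₂′ < r₁′, r₁ ≤ r₁′, and r₂ ≤ r₂′, one has φ(r₁, r₂) ≤ φ(r₁′, r₂′). Let α_i, α_j, c₁, c₂ be real numbers with c₁ ≤ α_i, c₂ ≤ α_j, α_j ≤ α_i, c₂ ≤ c₁, and c₂ ≥ min(c₁, α_j). Then φ(c₁, c₂) ≤ φ(α_i, α_j). -/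

import Mathlib

/-- Lemma 1 of the paper.  Let `φ : ℝ × ℝ → ℝ` be a transcoding-latency
function satisfying: `φ (r₁, r₂) ≥ 0` for all `r₁, r₂`; `φ (r₁, r₂) = 0`
whenever `r₁ ≤ r₂`; and `φ` is monotone on the transcoding region, i.e.,
whenever `r₂ < r₁`, `r₂' < r₁'`, `r₁ ≤ r₁'` and `r₂ ≤ r₂'`, one has
`φ (r₁, r₂) ≤ φ (r₁', r₂')`.  Let `αi, αj, c₁, c₂` be real numbers with
`c₁ ≤ αi`, `c₂ ≤ αj`, `αj ≤ αi`, `c₂ ≤ c₁`, and `c₂ ≥ min c₁ αj`.  Then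
`φ (c₁, c₂) ≤ φ (αi, αj)`. -/
theorem transcoding_latency_le
    (φ : ℝ × ℝ → ℝ)
    (hnn : ∀ r₁ r₂ : ℝ, 0 ≤ φ (r₁, r₂))
    (hzero : ∀ r₁ r₂ : ℝ, r₁ ≤ r₂ → φ (r₁, r₂) = 0)
    (hmono : ∀ r₁ r₂ r₁' r₂' : ℝ, r₂ < r₁ → r₂' < r₁' → r₁ ≤ r₁' → r₂ ≤ r₂' →
      φ (r₁, r₂) ≤ φ (r₁', r₂'))
    (αi αj c₁ c₂ : ℝ)
    (h1 : c₁ ≤ αi) (h2 : c₂ ≤ αj) (h3 : αj ≤ αi) (h4 : c₂ ≤ c₁)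
    (h5 : min c₁ αj ≤ c₂) :
    φ (c₁, c₂) ≤ φ (αi, αj) := by
  rcases le_or_gt c₁ c₂ with h | h
  · rw [hzero c₁ c₂ h]
    exact hnn _ _
  · have hj : αj ≤ c₂ := by
      rcases min_le_iff.mp h5 with h' | h'
      · exact absurd h' (not_le.mpr h)
      · exact h'
    exact hmono c₁ c₂ αi αj h (lt_of_le_of_lt hj (lt_of_lt_of_le h h1)) h1 h2
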